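/- Let k be the unique real root of k³ = k² − 1, let n and p be real numbers with p > 0, and set y₀(x) = kx. Define a = ((6 − 2n)k + (3n − 9)k² + (3 − n)k⁴)/(6(k² − 2)). Then the function y₁(x) = a·x²/p satisfies, for every x ≠ 0, the linear differential equation y₁'(x) = (6x³y₀(x) − 2n·x³y₀(x) − 9x²y₀(x)² + 3n·x²y₀(x)² + 3y₀(x)⁴ − n·y₀(x)⁴ + 6p·x²·y₁(x))/(3p·y₀(x)³). (Note k² − 2 ≠ 0 since k is negative and k² < 1, and y₀(x) ≠ 0 for x ≠ 0.) -/

import Mathlib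

/-- With `k` the unique real root of `k³ = k² − 1`, `y₀(x) = kx`, and
`a = ((6−2n)k + (3n−9)k² + (3−n)k⁴)/(6(k²−2))`, the function `y₁(x) = a·x²/p`
satisfies the first-order correction ODE
`y₁' = (6x³y₀ − 2nx³y₀ − 9x²y₀² + 3nx²y₀² + 3y₀⁴ − ny₀⁴ + 6px²y₁)/(3py₀³)`
for every `x ≠ 0`. -/
theorem perturbed_term_solution (k : ℝ) (hk : k ^ 3 = k ^ 2 - 1)
    (huniq : ∀ t : ℝ, t ^ 3 = t ^ 2 - 1 → t = k)
    (n p : ℝ) (hp : 0 < p) :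
    let a : ℝ := ((6 - 2 * n) * k + (3 * n - 9) * k ^ 2 + (3 - n) * k ^ 4)
      / (6 * (k ^ 2 - 2))
    let y₀ : ℝ → ℝ := fun x => k * x
    let y₁ : ℝ → ℝ := fun x => a * x ^ 2 / p
    ∀ x : ℝ, x ≠ 0 →
      deriv y₁ x =
        (6 * x ^ 3 * y₀ x - 2 * n * x ^ 3 * y₀ x - 9 * x ^ 2 * (y₀ x) ^ 2
            + 3 * n * x ^ 2 * (y₀ x) ^ 2 + 3 * (y₀ x) ^ 4 - n * (y₀ x) ^ 4
            + 6 * p * x ^ 2 * y₁ x)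
          / (3 * p * (y₀ x) ^ 3) := by
  intro a y₀ y₁ x hx
  have hk0 : k ≠ 0 := by
    rintro rfl
    norm_num at hk
  have hk2 : k ^ 2 - 2 ≠ 0 := by
    intro h
    have h1 : k = 1 / 2 := by
      have h2 : k ^ 3 = k * k ^ 2 := by ring
      have h3 : k ^ 2 = 2 := by linarith
      rw [h2, h3] at hk
      linarith
    rw [h1] at h
    norm_num at h
  have hp0 : p ≠ 0 := hp.ne'
  have ha : a * (6 * (k ^ 2 - 2))
      = (6 - 2 * n) * k + (3 * n - 9) * k ^ 2 + (3 - n) * k ^ 4 :=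
    div_mul_cancel₀ _ (mul_ne_zero (by norm_num) hk2)
  have hd : HasDerivAt y₁ (a * (2 * x) / p) x := by
    have h := ((hasDerivAt_pow 2 x).const_mul a).div_const p
    simpa using h
  rw [hd.deriv]
  change a * (2 * x) / p = (6 * x ^ 3 * (k * x) - 2 * n * x ^ 3 * (k * x)
    - 9 * x ^ 2 * (k * x) ^ 2 + 3 * n * x ^ 2 * (k * x) ^ 2 + 3 * (k * x) ^ 4
    - n * (k * x) ^ 4 + 6 * p * x ^ 2 * (a * x ^ 2 / p)) / (3 * p * (k * x) ^ 3)
  have hc : 6 * p * x ^ 2 * (a * x ^ 2 / p) = 6 * a * x ^ 4 := by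
    field_simp
  rw [hc, div_eq_div_iff hp0 (by positivity)]
  linear_combination (6 * a * p * x ^ 4) * hk + p * x ^ 4 * ha
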